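/- Let 𝒢1 = (G_1,…,G_d) and 𝒢2 = (G'_1,…,G'_{d'}) be snake graphs, let 1 < s ≤ d, and let (𝒢3 ⊔ 𝒢4, 𝒢5 ⊔ 𝒢6) = Graft_{s,δ_3}(𝒢1,𝒢2) be the resolution of the grafting of 𝒢2 on 𝒢1 in G_s. Then there is a bijection between Match(𝒢1) × Match(𝒢2) and the disjoint union (Match(𝒢3) × Match(𝒢4)) ⊔ (Match(𝒢5) × Match(𝒢6)); in particular |Match(𝒢1)|·|Match(𝒢2)| = |Match(𝒢3)|·|Match(𝒢4)| + |Match(𝒢5)|·|Match(𝒢6)|. -/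

import Mathlib

/-!
Basic definitions: tiles, snake graphs, perfect matchings, sign functions.

A tile is a unit square in the plane, identified by the coordinates of its
south-west corner.  An edge of the integer grid is encoded as a pair
`(p, b) : (ℤ × ℤ) × Bool` where `b = true` means the horizontal edge from `p`
to `p + (1,0)` and `b = false` means the vertical edge from `p` to `p + (0,1)`.

A snake graph is a sequence of tiles `G_1, …, G_d` (`d ≥ 1`) in which each
tile `G_{i+1}` is either the tile directly to the east or directly to the
north of `G_i`; this is exactly the combinatorial content of conditions
(i)–(iii) in the definition of a snake graph.  We record the position of the
first tile and the sequence of steps (`true` = east, `false` = north).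
-/

abbrev Pt : Type := ℤ × ℤ

/-- An edge of the integer grid: `(p, true)` is the horizontal unit edge with left
endpoint `p`, and `(p, false)` is the vertical unit edge with bottom endpoint `p`. -/
abbrev Edge : Type := Pt × Bool

/-- The two endpoints of an edge. -/
def Edge.ends (e : Edge) : Finset Pt :=
  {e.1, e.1 + (if e.2 then ((1 : ℤ), (0 : ℤ)) else ((0 : ℤ), (1 : ℤ)))}

/-- The south edge of the tile with south-west corner `p`. -/
def southEdge (p : Pt) : Edge := (p, true)
/-- The north edge of the tile with south-west corner `p`. -/
def northEdge (p : Pt) : Edge := (p + ((0 : ℤ), (1 : ℤ)), true)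
/-- The west edge of the tile with south-west corner `p`. -/
def westEdge (p : Pt) : Edge := (p, false)
/-- The east edge of the tile with south-west corner `p`. -/
def eastEdge (p : Pt) : Edge := (p + ((1 : ℤ), (0 : ℤ)), false)

/-- The four edges of the tile with south-west corner `p`. -/
def tileEdges (p : Pt) : Finset Edge := {southEdge p, northEdge p, westEdge p, eastEdge p}

/-- The four vertices of the tile with south-west corner `p`. -/
def tileVerts (p : Pt) : Finset Pt :=
  {p, p + ((1 : ℤ), (0 : ℤ)), p + ((0 : ℤ), (1 : ℤ)), p + ((1 : ℤ), (1 : ℤ))}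

/-- A snake graph `𝒢 = (G_1, …, G_d)`, `d ≥ 1`: a sequence of tiles in which each
tile `G_{i+1}` shares exactly one edge with `G_i`, this edge being the north edge of
`G_i` and the south edge of `G_{i+1}`, or the east edge of `G_i` and the west edge of
`G_{i+1}`.  `step i = true` means `G_{i+1}` is east of `G_i`, `step i = false` means
`G_{i+1}` is north of `G_i`; only the values `step i` for `1 ≤ i ≤ d - 1` are
relevant. -/
structure SnakeGraph where
  d : ℕ
  one_le_d : 1 ≤ d
  base : Pt
  step : ℕ → Bool

namespace SnakeGraph

/-- The south-west corner of the `i`-th tile, `1 ≤ i ≤ d`. -/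
def pos (G : SnakeGraph) (i : ℕ) : Pt :=
  G.base + ∑ j ∈ Finset.Ico 1 i,
    (if G.step j then ((1 : ℤ), (0 : ℤ)) else ((0 : ℤ), (1 : ℤ)))

/-- The set of edges of the snake graph. -/
def edges (G : SnakeGraph) : Finset Edge :=
  (Finset.Icc 1 G.d).biUnion fun i => tileEdges (G.pos i)

/-- The set of vertices of the snake graph. -/
def verts (G : SnakeGraph) : Finset Pt :=
  (Finset.Icc 1 G.d).biUnion fun i => tileVerts (G.pos i)

/-- The interior edge `e_i` shared by the tiles `G_i` and `G_{i+1}` (`1 ≤ i ≤ d-1`). -/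
def intEdge (G : SnakeGraph) (i : ℕ) : Edge :=
  if G.step i then eastEdge (G.pos i) else northEdge (G.pos i)

/-- An edge is interior if it is one of the edges `e_1, …, e_{d-1}`. -/
def IsInteriorEdge (G : SnakeGraph) (e : Edge) : Prop :=
  ∃ i, 1 ≤ i ∧ i < G.d ∧ e = G.intEdge i

/-- A boundary edge is an edge of the snake graph which is not interior. -/
def IsBoundaryEdge (G : SnakeGraph) (e : Edge) : Prop :=
  e ∈ G.edges ∧ ¬ G.IsInteriorEdge e

/-- A perfect matching of the snake graph: a set of edges of `G` such that every
vertex of `G` is incident to exactly one edge of the set. -/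
def IsPerfectMatching (G : SnakeGraph) (P : Finset Edge) : Prop :=
  (∀ e ∈ P, e ∈ G.edges) ∧ ∀ v ∈ G.verts, ∃! e, e ∈ P ∧ v ∈ Edge.ends e

/-- A sign function on the snake graph: on every tile the north and west edges have
the same sign, the south and east edges have the same sign, and the signs of the
north and south edges are opposite.  (Signs are encoded as `Bool`.) -/
def IsSignFunction (G : SnakeGraph) (f : Edge → Bool) : Prop :=
  ∀ i, 1 ≤ i → i ≤ G.d →
    f (northEdge (G.pos i)) = f (westEdge (G.pos i)) ∧
    f (southEdge (G.pos i)) = f (eastEdge (G.pos i)) ∧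
    f (northEdge (G.pos i)) = ! f (southEdge (G.pos i))

end SnakeGraph

/-! ### The set of perfect matchings -/

open Classical in
/-- The (finite) set of perfect matchings of a snake graph. -/
noncomputable def SnakeGraph.matchings (G : SnakeGraph) : Finset (Finset Edge) :=
  G.edges.powerset.filter fun P => G.IsPerfectMatching P

/-- A snake graph, or (by convention) an "empty snake graph" consisting of a single
edge.  The latter arises in resolutions of crossings and of graftings. -/
inductive SnakeOrEdge : Type
  | snake (G : SnakeGraph)
  | single (e : Edge)

/-- The set of perfect matchings: a single edge has exactly one perfect matching,
consisting of that edge. -/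
noncomputable def SnakeOrEdge.matchings : SnakeOrEdge → Finset (Finset Edge)
  | .snake G => G.matchings
  | .single e => {{e}}

/-! ### The resolution `Graft_{s,δ₃}(𝒢1,𝒢2)` of a grafting

We specify the four graphs `𝒢3, 𝒢4, 𝒢5, 𝒢6` of the resolution of the grafting of
`𝒢2` on `𝒢1` in `G_s` by predicates on their numbers of tiles and step sequences
(their position in the plane being irrelevant).  Recall that `𝒢̄` denotes the
reflection of `𝒢` reversing the order of the tiles; under this reflection east
steps become north steps and vice versa, and the north/east/south/west edges of a
tile become the west/south/east/north edges of the image tile. -/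

/-- `H` is (a translate of) the sub-snake graph `𝒢[a,b]` of `𝒢`. -/
def SubSpec (G : SnakeGraph) (a b : ℕ) (H : SnakeGraph) : Prop :=
  H.d = b - a + 1 ∧ ∀ i, 1 ≤ i → i < H.d → H.step i = G.step (i + a - 1)

/-- `H` is (a translate of) the reflected snake graph `𝒢̄[b,a]`, whose `i`-th tile is
the `(b+1-i)`-th tile of `𝒢`. -/
def RevSubSpec (G : SnakeGraph) (a b : ℕ) (H : SnakeGraph) : Prop :=
  H.d = b - a + 1 ∧ ∀ i, 1 ≤ i → i < H.d → H.step i = ! G.step (b - i)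

/-- For `1 < s < d`: if `G_{s+1}` is north of `G_s`, then `δ₃` is the east edge of
`G_s` and `δ'₃` is the west edge of `G'_1`; if `G_{s+1}` is east of `G_s`, then `δ₃`
is the north edge of `G_s` and `δ'₃` is the south edge of `G'_1`.
For `s = d`: `(δ₃, δ'₃)` is a chosen pair where either `δ₃` is the north edge of
`G_s` and `δ'₃` the south edge of `G'_1`, or `δ₃` is the east edge of `G_s` and
`δ'₃` the west edge of `G'_1`. -/
def GraftEdgeSpec (G1 G2 : SnakeGraph) (s : ℕ) (δ3 δ3' : Edge) : Prop :=
  (s < G1.d →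
    ((G1.step s = false → δ3 = eastEdge (G1.pos s) ∧ δ3' = westEdge (G2.pos 1)) ∧
     (G1.step s = true → δ3 = northEdge (G1.pos s) ∧ δ3' = southEdge (G2.pos 1)))) ∧
  (s = G1.d →
    ((δ3 = northEdge (G1.pos s) ∧ δ3' = southEdge (G2.pos 1)) ∨
     (δ3 = eastEdge (G1.pos s) ∧ δ3' = westEdge (G2.pos 1))))

/-- `𝒢3 = 𝒢1[1,s] ∪ 𝒢2`, where the two subgraphs are glued along the edges `δ₃`
and `δ'₃` (so `G'_1` is north of `G_s` if `δ₃` is the north edge of `G_s`, and east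
of `G_s` if `δ₃` is the east edge of `G_s`). -/
def Graft3Spec (G1 G2 : SnakeGraph) (s : ℕ) (δ3 : Edge) (G3 : SnakeGraph) : Prop :=
  G3.d = s + G2.d ∧
  (∀ i, 1 ≤ i → i < s → G3.step i = G1.step i) ∧
  (δ3 = northEdge (G1.pos s) → G3.step s = false) ∧
  (δ3 = eastEdge (G1.pos s) → G3.step s = true) ∧
  (∀ i, s < i → i < G3.d → G3.step i = G2.step (i - s))

/-- The graph `𝒢4` of the resolution of the grafting:
* if `1 < s < d`, `𝒢4 = 𝒢1[k₄,d]` where `k₄ > s+1` is the least integer with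
  `f1(e_s) = -f1(e_{k₄-1})`, or the single edge `e_d` of `G_d` which is north or
  east and satisfies `f1(e_s) = -f1(e_d)` if no such `k₄` exists;
* if `s = d`, `𝒢4 = {δ₃}`. -/
def Graft4Spec (G1 : SnakeGraph) (s : ℕ) (f1 : Edge → Bool) (δ3 : Edge)
    (G4 : SnakeOrEdge) : Prop :=
  (s < G1.d ∧
    ((∃ k4, s + 1 < k4 ∧ k4 ≤ G1.d ∧
        f1 (G1.intEdge s) = ! f1 (G1.intEdge (k4 - 1)) ∧
        (∀ j, s + 1 < j → j < k4 → f1 (G1.intEdge s) ≠ ! f1 (G1.intEdge (j - 1))) ∧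
        ∃ H : SnakeGraph, G4 = .snake H ∧ SubSpec G1 k4 G1.d H) ∨
     ((∀ k, s + 1 < k → k ≤ G1.d → f1 (G1.intEdge s) ≠ ! f1 (G1.intEdge (k - 1))) ∧
        ∃ e : Edge, G4 = .single e ∧
          (e = northEdge (G1.pos G1.d) ∨ e = eastEdge (G1.pos G1.d)) ∧
          f1 (G1.intEdge s) = ! f1 e))) ∨
  (s = G1.d ∧ G4 = .single δ3)

/-- Auxiliary: `𝒢5 = 𝒢1[1,k₅]` where `k₅ < s` is the largest integer with
`f1(e_{k₅}) = b`, or the single edge `e₀` of `G_1` which is south or west and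
satisfies `f1(e₀) = b` if no such `k₅` exists. -/
def Graft5Aux (G1 : SnakeGraph) (s : ℕ) (f1 : Edge → Bool) (b : Bool)
    (G5 : SnakeOrEdge) : Prop :=
  (∃ k5, 1 ≤ k5 ∧ k5 < s ∧ f1 (G1.intEdge k5) = b ∧
      (∀ j, k5 < j → j < s → f1 (G1.intEdge j) ≠ b) ∧
      ∃ H : SnakeGraph, G5 = .snake H ∧ SubSpec G1 1 k5 H) ∨
  ((∀ j, 1 ≤ j → j < s → f1 (G1.intEdge j) ≠ b) ∧
      ∃ e : Edge, G5 = .single e ∧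
        (e = southEdge (G1.pos 1) ∨ e = westEdge (G1.pos 1)) ∧ f1 e = b)

/-- The graph `𝒢5` of the resolution of the grafting: for `1 < s < d` it is cut off
at the largest `k₅ < s` with `f1(e_{k₅}) = -f1(e_s)`; for `s = d` at the largest
`k₅ < s` with `f1(e_{k₅}) = f1(δ₃)`. -/
def Graft5Spec (G1 : SnakeGraph) (s : ℕ) (f1 : Edge → Bool) (δ3 : Edge)
    (G5 : SnakeOrEdge) : Prop :=
  (s < G1.d ∧ Graft5Aux G1 s f1 (! f1 (G1.intEdge s)) G5) ∨
  (s = G1.d ∧ Graft5Aux G1 s f1 (f1 δ3) G5)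

/-- The graph `𝒢6` of the resolution of the grafting:
* if `1 < s < d`, `𝒢6 = 𝒢̄2[d',1] ∪ 𝒢1[s+1,d]`, glued along the edges `δ₅` and
  `δ'₅` (where, if `G_{s+1}` is north of `G_s`, `δ₅` is the west edge of `G_{s+1}`
  and `δ'₅` the south edge of `G'_1`, and, if `G_{s+1}` is east of `G_s`, `δ₅` is
  the south edge of `G_{s+1}` and `δ'₅` the west edge of `G'_1`);
* if `s = d`, `𝒢6 = 𝒢̄2[d',k₆]` where `k₆ > 1` is the least integer with
  `f2(e'_{k₆-1}) = f1(δ₃)`, or the single edge of `G'_{d'}` which is south or west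
  and has sign `f1(δ₃)` if no such `k₆` exists. -/
def Graft6Spec (G1 G2 : SnakeGraph) (s : ℕ) (f1 f2 : Edge → Bool) (δ3 : Edge)
    (G6 : SnakeOrEdge) : Prop :=
  (s < G1.d ∧ ∃ H : SnakeGraph, G6 = .snake H ∧
      H.d = G2.d + (G1.d - s) ∧
      (∀ i, 1 ≤ i → i < G2.d → H.step i = ! G2.step (G2.d - i)) ∧
      H.step G2.d = ! G1.step s ∧
      (∀ i, G2.d < i → i < H.d → H.step i = G1.step (i - G2.d + s))) ∨
  (s = G1.d ∧
    ((∃ k6, 1 < k6 ∧ k6 ≤ G2.d ∧ f2 (G2.intEdge (k6 - 1)) = f1 δ3 ∧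
        (∀ j, 1 < j → j < k6 → f2 (G2.intEdge (j - 1)) ≠ f1 δ3) ∧
        ∃ H : SnakeGraph, G6 = .snake H ∧ RevSubSpec G2 k6 G2.d H) ∨
     ((∀ j, 1 < j → j ≤ G2.d → f2 (G2.intEdge (j - 1)) ≠ f1 δ3) ∧
        ∃ e : Edge, G6 = .single e ∧
          (e = southEdge (G2.pos G2.d) ∨ e = westEdge (G2.pos G2.d)) ∧
          f2 e = f1 δ3)))


/-! ### Perfect matchings: general counting lemmas -/

open Classical in
noncomputable def PMs (V : Finset Pt) (E : Finset Edge) : Finset (Finset Edge) :=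
  E.powerset.filter fun P => (∀ e ∈ P, Edge.ends e ⊆ V) ∧ ∀ v ∈ V, ∃! e, e ∈ P ∧ v ∈ Edge.ends e

theorem mem_PMs {V : Finset Pt} {E P : Finset Edge} : P ∈ PMs V E ↔
    P ⊆ E ∧ (∀ e ∈ P, Edge.ends e ⊆ V) ∧ ∀ v ∈ V, ∃! e, e ∈ P ∧ v ∈ Edge.ends e := by
  simp [PMs]

theorem PMs_del (V : Finset Pt) (E : Finset Edge) (e : Edge) (he : e ∈ E)
    (hV : Edge.ends e ⊆ V) :
    ((PMs V E).filter (fun P => e ∈ P)).card = (PMs (V \ Edge.ends e) E).card := by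
  have hne : e.1 ∈ Edge.ends e := by simp [Edge.ends]
  have hnot : ∀ Q ∈ PMs (V \ Edge.ends e) E, e ∉ Q := by
    intro Q hQ h
    have := (mem_PMs.1 hQ).2.1 e h hne
    simp [hne] at this
  refine Finset.card_bij' (fun P _ => P.erase e) (fun Q _ => insert e Q) ?_ ?_ ?_ ?_
  · intro P hP
    rw [Finset.mem_filter, mem_PMs] at hP
    obtain ⟨⟨h1, h2, h3⟩, h4⟩ := hP
    rw [mem_PMs]
    refine ⟨fun x hx => h1 (Finset.mem_of_mem_erase hx), ?_, ?_⟩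
    · intro x hx v hv
      rw [Finset.mem_erase] at hx
      rw [Finset.mem_sdiff]
      refine ⟨h2 x hx.2 hv, fun hve => hx.1 ?_⟩
      exact (h3 v (hV hve)).unique ⟨hx.2, hv⟩ ⟨h4, hve⟩
    · intro v hv
      rw [Finset.mem_sdiff] at hv
      obtain ⟨x, hx, hu⟩ := h3 v hv.1
      refine ⟨x, ⟨Finset.mem_erase.2 ⟨?_, hx.1⟩, hx.2⟩, ?_⟩
      · rintro rfl
        exact hv.2 hx.2
      · rintro y ⟨hy, hvy⟩
        exact hu y ⟨Finset.mem_of_mem_erase hy, hvy⟩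
  · intro Q hQ
    have hn := hnot Q hQ
    rw [mem_PMs] at hQ
    obtain ⟨h1, h2, h3⟩ := hQ
    rw [Finset.mem_filter, mem_PMs]
    refine ⟨⟨?_, ?_, ?_⟩, Finset.mem_insert_self _ _⟩
    · intro x hx
      rcases Finset.mem_insert.1 hx with rfl | hx
      · exact he
      · exact h1 hx
    · intro x hx
      rcases Finset.mem_insert.1 hx with rfl | hx
      · exact hV
      · exact (h2 x hx).trans Finset.sdiff_subset
    · intro v hv
      by_cases hve : v ∈ Edge.ends e
      · refine ⟨e, ⟨Finset.mem_insert_self _ _, hve⟩, ?_⟩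
        rintro y ⟨hy, hvy⟩
        rcases Finset.mem_insert.1 hy with rfl | hy
        · rfl
        · have := h2 y hy hvy
          simp [hve] at this
      · obtain ⟨x, hx, hu⟩ := h3 v (Finset.mem_sdiff.2 ⟨hv, hve⟩)
        refine ⟨x, ⟨Finset.mem_insert_of_mem hx.1, hx.2⟩, ?_⟩
        rintro y ⟨hy, hvy⟩
        rcases Finset.mem_insert.1 hy with rfl | hy
        · exact absurd hvy hve
        · exact hu y ⟨hy, hvy⟩
  · intro P hP
    exact Finset.insert_erase (Finset.mem_filter.1 hP).2
  · intro Q hQ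
    exact Finset.erase_insert (hnot Q hQ)

theorem PMs_congr {V : Finset Pt} {E E' : Finset Edge} (hE : E ⊆ E')
    (h : ∀ x ∈ E', Edge.ends x ⊆ V → x ∈ E) : PMs V E' = PMs V E := by
  ext P
  rw [mem_PMs, mem_PMs]
  constructor
  · rintro ⟨h1, h2, h3⟩
    exact ⟨fun x hx => h x (h1 hx) (h2 x hx), h2, h3⟩
  · rintro ⟨h1, h2, h3⟩
    exact ⟨h1.trans hE, h2, h3⟩

section addTile

variable (V V' : Finset Pt) (E E' : Finset Edge) (a b c d : Pt) (e f g h : Edge)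

theorem step_h (hV' : V' = V ∪ {c, d}) (hE' : E' = E ∪ {f, g, h})
    (hf : Edge.ends f = {a, c}) (hg : Edge.ends g = {b, d}) (hh : Edge.ends h = {c, d})
    (hc : c ∉ V) (hd : d ∉ V) :
    ((PMs V' E').filter (fun P => h ∈ P)).card = (PMs V E).card := by
  rw [PMs_del _ _ _ (by simp [hE']) (by simp [hV', hh])]
  have : V' \ Edge.ends h = V := by
    ext v
    simp only [hV', hh, Finset.mem_sdiff, Finset.mem_union, Finset.mem_insert,
      Finset.mem_singleton]
    grind
  rw [this, PMs_congr (E := E) (by rw [hE']; exact Finset.subset_union_left)]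
  intro x hx hxV
  simp only [hE', Finset.mem_union, Finset.mem_insert, Finset.mem_singleton] at hx
  rcases hx with hx | rfl | rfl | rfl
  · exact hx
  · exact absurd (hxV (by simp [hf])) hc
  · exact absurd (hxV (by simp [hg])) hd
  · exact absurd (hxV (by simp [hh])) hd

theorem step_f (hV' : V' = V ∪ {c, d}) (hE' : E' = E ∪ {f, g, h})
    (he : Edge.ends e = {a, b}) (heE : e ∈ E)
    (hf : Edge.ends f = {a, c}) (hg : Edge.ends g = {b, d}) (hh : Edge.ends h = {c, d})
    (hc : c ∉ V) (hd : d ∉ V) (hab : a ≠ b) (hcd : c ≠ d)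
    (hEV : ∀ x ∈ E, Edge.ends x ⊆ V) :
    ((PMs V' E').filter (fun P => f ∈ P)).card =
      ((PMs V E).filter (fun P => e ∈ P)).card := by
  have haV : a ∈ V := hEV e heE (by simp [he])
  have hbV : b ∈ V := hEV e heE (by simp [he])
  have hbc : b ≠ c := by rintro rfl; exact hc hbV
  have had : a ≠ d := by rintro rfl; exact hd haV
  rw [PMs_del _ _ _ (by simp [hE']) (by simp [hV', hf, haV, Finset.insert_subset_iff]),
    PMs_del V E e heE (hEV e heE)]
  have h1 : (PMs (V' \ Edge.ends f) E').filter (fun P => g ∈ P) = PMs (V' \ Edge.ends f) E' := by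
    rw [Finset.filter_eq_self]
    intro P hP
    rw [mem_PMs] at hP
    obtain ⟨p1, p2, p3⟩ := hP
    obtain ⟨x, ⟨hx, hdx⟩, -⟩ := p3 d (by
      simp [hV', hf, had.symm, hcd.symm])
    have hx' := p1 hx
    simp only [hE', Finset.mem_union, Finset.mem_insert, Finset.mem_singleton] at hx'
    rcases hx' with hx' | rfl | rfl | rfl
    · exact absurd (hEV x hx' hdx) hd
    · have := p2 _ hx hdx
      simp [hdx] at this
    · exact hx
    · have := p2 _ hx (show c ∈ _ by simp [hh])
      simp [hf] at this
  rw [← h1, PMs_del _ _ _ (by simp [hE']) (by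
    simp [hV', hf, hg, Finset.insert_subset_iff, hbV, hab.symm, hbc, had.symm, hcd.symm])]
  have : (V' \ Edge.ends f) \ Edge.ends g = V \ Edge.ends e := by
    ext v
    simp only [hV', hf, hg, he, Finset.mem_sdiff, Finset.mem_union, Finset.mem_insert,
      Finset.mem_singleton]
    grind
  rw [this, PMs_congr (E := E) (by rw [hE']; exact Finset.subset_union_left)]
  intro x hx hxV
  simp only [hE', Finset.mem_union, Finset.mem_insert, Finset.mem_singleton] at hx
  have hxV := hxV.trans Finset.sdiff_subset
  rcases hx with hx | rfl | rfl | rfl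
  · exact hx
  · exact absurd (hxV (by simp [hf])) hc
  · exact absurd (hxV (by simp [hg])) hd
  · exact absurd (hxV (by simp [hh])) hd

end addTile

/-! ### Geometry of snake graphs -/

namespace SnakeGraph

def VV (G : SnakeGraph) (n : ℕ) : Finset Pt :=
  (Finset.Icc 1 n).biUnion fun i => tileVerts (G.pos i)

def EE (G : SnakeGraph) (n : ℕ) : Finset Edge :=
  (Finset.Icc 1 n).biUnion fun i => tileEdges (G.pos i)

theorem pos_succ (G : SnakeGraph) (n : ℕ) (hn : 1 ≤ n) : G.pos (n + 1) =
    G.pos n + (if G.step n then ((1 : ℤ), (0 : ℤ)) else ((0 : ℤ), (1 : ℤ))) := by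
  rw [pos, pos, Finset.sum_Ico_succ_top hn, add_assoc]

theorem VV_succ (G : SnakeGraph) (n : ℕ) :
    G.VV (n + 1) = G.VV n ∪ tileVerts (G.pos (n + 1)) := by
  ext v
  simp only [VV, Finset.mem_biUnion, Finset.mem_union, Finset.mem_Icc]
  constructor
  · rintro ⟨i, hi, hv⟩
    by_cases h : i = n + 1
    · subst h; exact Or.inr hv
    · exact Or.inl ⟨i, by omega, hv⟩
  · rintro (⟨i, hi, hv⟩ | hv)
    · exact ⟨i, by omega, hv⟩
    · exact ⟨n + 1, by omega, hv⟩

theorem EE_succ (G : SnakeGraph) (n : ℕ) :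
    G.EE (n + 1) = G.EE n ∪ tileEdges (G.pos (n + 1)) := by
  ext v
  simp only [EE, Finset.mem_biUnion, Finset.mem_union, Finset.mem_Icc]
  constructor
  · rintro ⟨i, hi, hv⟩
    by_cases h : i = n + 1
    · subst h; exact Or.inr hv
    · exact Or.inl ⟨i, by omega, hv⟩
  · rintro (⟨i, hi, hv⟩ | hv)
    · exact ⟨i, by omega, hv⟩
    · exact ⟨n + 1, by omega, hv⟩

theorem tile_ends (p : Pt) (x : Edge) (hx : x ∈ tileEdges p) : Edge.ends x ⊆ tileVerts p := by
  obtain ⟨p1, p2⟩ := p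
  simp only [tileEdges, Finset.mem_insert, Finset.mem_singleton] at hx
  rcases hx with rfl | rfl | rfl | rfl <;>
  · intro v hv
    obtain ⟨v1, v2⟩ := v
    simp [Edge.ends, tileVerts, southEdge, northEdge, westEdge, eastEdge] at hv ⊢
    omega

theorem EE_ends (G : SnakeGraph) (n : ℕ) (x : Edge) (hx : x ∈ G.EE n) :
    Edge.ends x ⊆ G.VV n := by
  simp only [EE, Finset.mem_biUnion] at hx
  obtain ⟨i, hi, hx⟩ := hx
  exact (tile_ends _ _ hx).trans (Finset.subset_biUnion_of_mem (fun i => tileVerts (G.pos i)) hi)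

theorem matchings_eq (G : SnakeGraph) : G.matchings = PMs (G.VV G.d) (G.EE G.d) := by
  ext P
  rw [mem_PMs]
  simp only [matchings, Finset.mem_filter, Finset.mem_powerset]
  constructor
  · rintro ⟨h1, _, h3⟩
    exact ⟨h1, fun e he => G.EE_ends _ e (h1 he), h3⟩
  · rintro ⟨h1, _, h3⟩
    exact ⟨h1, fun e he => h1 he, h3⟩

theorem VV_bound (G : SnakeGraph) (n : ℕ) (hn : 1 ≤ n) (v : Pt) (hv : v ∈ G.VV n) :
    v.1 ≤ (G.pos n).1 + 1 ∧ v.2 ≤ (G.pos n).2 + 1 := by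
  induction n, hn using Nat.le_induction with
  | base =>
    simp [VV, tileVerts] at hv
    obtain ⟨v1, v2⟩ := v
    rcases hv with h | h | h | h <;> simp [Prod.ext_iff] at h <;> simp [h.1, h.2]
  | succ n hn ih =>
    rw [VV_succ, Finset.mem_union] at hv
    rcases hv with hv | hv
    · have := ih hv
      rw [pos_succ _ _ hn]
      split_ifs <;> simp <;> omega
    · generalize G.pos (n + 1) = q at hv
      simp [tileVerts] at hv
      obtain ⟨v1, v2⟩ := v
      rcases hv with h | h | h | h <;> simp [Prod.ext_iff] at h <;> simp [h.1, h.2]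

theorem last_mem (G : SnakeGraph) (n : ℕ) (hn : 1 ≤ n) (x : Edge)
    (hx : x ∈ tileEdges (G.pos n)) : x ∈ G.EE n := by
  simp only [EE, Finset.mem_biUnion]
  exact ⟨n, by simp [hn], hx⟩

noncomputable def NN (G : SnakeGraph) (n : ℕ) : ℕ :=
  ((PMs (G.VV n) (G.EE n)).filter (fun P => northEdge (G.pos n) ∈ P)).card
noncomputable def EN (G : SnakeGraph) (n : ℕ) : ℕ :=
  ((PMs (G.VV n) (G.EE n)).filter (fun P => eastEdge (G.pos n) ∈ P)).card

theorem north_ne_east (p q : Pt) : northEdge p ≠ eastEdge q := by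
  simp [northEdge, eastEdge]

theorem PMs_card (G : SnakeGraph) (n : ℕ) (hn : 1 ≤ n) :
    (PMs (G.VV n) (G.EE n)).card = G.NN n + G.EN n := by
  rw [NN, EN, ← Finset.card_filter_add_card_filter_not (fun P => northEdge (G.pos n) ∈ P)]
  congr 2
  ext P
  simp only [Finset.mem_filter, and_congr_right_iff]
  intro hP
  have hP' := hP
  rw [mem_PMs] at hP
  obtain ⟨h1, h2, h3⟩ := hP
  have hmem : G.pos n + (1, 1) ∈ G.VV n := by
    simp only [VV, Finset.mem_biUnion]
    exact ⟨n, by simp [hn], by simp [tileVerts]⟩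
  obtain ⟨x, ⟨hx, hvx⟩, hu⟩ := h3 _ hmem
  have hNv : G.pos n + (1, 1) ∈ Edge.ends (northEdge (G.pos n)) := by
    simp [Edge.ends, northEdge, add_assoc]
  have hEv : G.pos n + (1, 1) ∈ Edge.ends (eastEdge (G.pos n)) := by
    simp [Edge.ends, eastEdge, add_assoc]
  have hor : x = northEdge (G.pos n) ∨ x = eastEdge (G.pos n) := by
    have hb := fun v hv => G.VV_bound n hn v (h2 x hx hv)
    obtain ⟨⟨x1, x2⟩, xb⟩ := x
    generalize G.pos n = q at *
    obtain ⟨q1, q2⟩ := q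
    have hb' := hb _ (show (x1, x2) + _ ∈ _ from Finset.mem_insert_of_mem
      (Finset.mem_singleton_self _))
    cases xb <;> simp [Edge.ends, northEdge, eastEdge] at hvx hb' ⊢ <;> omega
  constructor
  · intro hno
    rcases hor with rfl | rfl
    · exact absurd hx hno
    · exact hx
  · intro hE hN
    exact north_ne_east _ _ ((hu _ ⟨hN, hNv⟩).trans (hu _ ⟨hE, hEv⟩).symm)

theorem ends_south (p : Pt) : Edge.ends (southEdge p) = {p, p + (1, 0)} := by
  simp [Edge.ends, southEdge]
theorem ends_west (p : Pt) : Edge.ends (westEdge p) = {p, p + (0, 1)} := by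
  simp [Edge.ends, westEdge]
theorem ends_north (p : Pt) : Edge.ends (northEdge p) = {p + (0, 1), p + (1, 1)} := by
  simp [Edge.ends, northEdge, add_assoc]
theorem ends_east (p : Pt) : Edge.ends (eastEdge p) = {p + (1, 0), p + (1, 1)} := by
  simp [Edge.ends, eastEdge, add_assoc]

theorem PMs_edge (e : Edge) : PMs (Edge.ends e) {e} = {{e}} := by
  have hne : e.1 ∈ Edge.ends e := by simp [Edge.ends]
  ext P
  rw [mem_PMs, Finset.mem_singleton]
  constructor
  · rintro ⟨h1, -, h3⟩
    obtain ⟨x, ⟨hx, -⟩, -⟩ := h3 _ hne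
    rcases Finset.subset_singleton_iff.1 h1 with rfl | h
    · simp at hx
    · exact h
  · rintro rfl
    refine ⟨subset_rfl, by simp, fun v hv => ⟨e, by simp [hv], by simp⟩⟩

theorem base_counts (G : SnakeGraph) : G.NN 1 = 1 ∧ G.EN 1 = 1 := by
  set p := G.pos 1 with hp
  have hV' : G.VV 1 = Edge.ends (westEdge p) ∪ {p + (1, 1), p + (1, 0)} := by
    ext v
    simp only [VV, ends_west, tileVerts, Finset.Icc_self, Finset.singleton_biUnion,
      Finset.mem_union, Finset.mem_insert, Finset.mem_singleton, ← hp]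
    tauto
  have hE' : G.EE 1 = {westEdge p} ∪ {northEdge p, southEdge p, eastEdge p} := by
    ext v
    simp only [EE, tileEdges, Finset.Icc_self, Finset.singleton_biUnion,
      Finset.mem_union, Finset.mem_insert, Finset.mem_singleton, ← hp]
    tauto
  have hc : p + (1, 1) ∉ Edge.ends (westEdge p) := by simp [ends_west]
  have hd : p + (1, 0) ∉ Edge.ends (westEdge p) := by simp [ends_west]
  have hEV : ∀ x ∈ ({westEdge p} : Finset Edge), Edge.ends x ⊆ Edge.ends (westEdge p) := by
    simp
  constructor
  · rw [NN, step_f _ _ _ _ (p + (0, 1)) p _ _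
      (westEdge p) _ _ _ hV' hE' (by rw [ends_west, Finset.pair_comm]) (by simp)
      (ends_north _) (ends_south _) (by rw [ends_east, Finset.pair_comm]) hc hd (by simp)
      (by simp) hEV, PMs_edge]
    simp [Finset.filter_singleton]
  · rw [EN, step_h _ _ _ _ (p + (0, 1)) p _ _
      _ _ _ hV' hE'
      (ends_north _) (ends_south _) (by rw [ends_east, Finset.pair_comm]) hc hd, PMs_edge]
    rfl

theorem step_counts (G : SnakeGraph) (n : ℕ) (hn : 1 ≤ n) :
    (G.step n = true → G.NN (n + 1) = G.EN n ∧ G.EN (n + 1) = G.NN n + G.EN n) ∧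
    (G.step n = false → G.EN (n + 1) = G.NN n ∧ G.NN (n + 1) = G.NN n + G.EN n) := by
  have hEV := G.EE_ends n
  have hbd := G.VV_bound n hn
  have hVn : tileVerts (G.pos n) ⊆ G.VV n := by
    exact Finset.subset_biUnion_of_mem (fun i => tileVerts (G.pos i)) (by simp [hn])
  constructor
  · intro hs
    have hq : G.pos (n + 1) = G.pos n + (1, 0) := by rw [pos_succ _ _ hn]; simp [hs]
    have hwe : westEdge (G.pos (n + 1)) = eastEdge (G.pos n) := by
      rw [hq]; rfl
    have heE : westEdge (G.pos (n + 1)) ∈ G.EE n := by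
      rw [hwe]; exact G.last_mem n hn _ (by simp [tileEdges])
    have hV' : G.VV (n + 1) = G.VV n ∪ {G.pos (n + 1) + (1, 1), G.pos (n + 1) + (1, 0)} := by
      have h1 : G.pos (n + 1) ∈ G.VV n := hEV _ heE (by simp [ends_west])
      have h2 : G.pos (n + 1) + (0, 1) ∈ G.VV n := hEV _ heE (by simp [ends_west])
      rw [VV_succ]
      ext v
      simp only [tileVerts, Finset.mem_union, Finset.mem_insert, Finset.mem_singleton]
      grind
    have hE' : G.EE (n + 1) = G.EE n ∪ {northEdge (G.pos (n + 1)), southEdge (G.pos (n + 1)),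
        eastEdge (G.pos (n + 1))} := by
      rw [EE_succ]
      ext v
      simp only [tileEdges, Finset.mem_union, Finset.mem_insert, Finset.mem_singleton]
      grind
    have hc : G.pos (n + 1) + (1, 1) ∉ G.VV n := by
      intro h; have := hbd _ h; simp [hq] at this
    have hd : G.pos (n + 1) + (1, 0) ∉ G.VV n := by
      intro h; have := hbd _ h; simp [hq] at this
    constructor
    · rw [NN, EN, step_f _ _ _ _ (G.pos (n + 1) + (0, 1)) (G.pos (n + 1)) _ _
        (westEdge (G.pos (n + 1))) _ _ _ hV' hE' (by rw [ends_west, Finset.pair_comm]) heE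
        (ends_north _) (ends_south _) (by rw [ends_east, Finset.pair_comm]) hc hd (by simp)
        (by simp) hEV, hwe]
    · rw [EN, step_h _ _ _ _ (G.pos (n + 1) + (0, 1)) (G.pos (n + 1)) _ _
        _ _ _ hV' hE' 
        (ends_north _) (ends_south _) (by rw [ends_east, Finset.pair_comm]) hc hd,
        PMs_card _ _ hn]
  · intro hs
    have hq : G.pos (n + 1) = G.pos n + (0, 1) := by rw [pos_succ _ _ hn]; simp [hs]
    have hwe : southEdge (G.pos (n + 1)) = northEdge (G.pos n) := by
      rw [hq]; rfl
    have heE : southEdge (G.pos (n + 1)) ∈ G.EE n := by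
      rw [hwe]; exact G.last_mem n hn _ (by simp [tileEdges])
    have hV' : G.VV (n + 1) = G.VV n ∪ {G.pos (n + 1) + (1, 1), G.pos (n + 1) + (0, 1)} := by
      have h1 : G.pos (n + 1) ∈ G.VV n := hEV _ heE (by simp [ends_south])
      have h2 : G.pos (n + 1) + (1, 0) ∈ G.VV n := hEV _ heE (by simp [ends_south])
      rw [VV_succ]
      ext v
      simp only [tileVerts, Finset.mem_union, Finset.mem_insert, Finset.mem_singleton]
      grind
    have hE' : G.EE (n + 1) = G.EE n ∪ {eastEdge (G.pos (n + 1)), westEdge (G.pos (n + 1)),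
        northEdge (G.pos (n + 1))} := by
      rw [EE_succ]
      ext v
      simp only [tileEdges, Finset.mem_union, Finset.mem_insert, Finset.mem_singleton]
      grind
    have hc : G.pos (n + 1) + (1, 1) ∉ G.VV n := by
      intro h; have := hbd _ h; simp [hq] at this
    have hd : G.pos (n + 1) + (0, 1) ∉ G.VV n := by
      intro h; have := hbd _ h; simp [hq] at this
    constructor
    · rw [NN, EN, step_f _ _ _ _ (G.pos (n + 1) + (1, 0)) (G.pos (n + 1)) _ _
        (southEdge (G.pos (n + 1))) _ _ _ hV' hE' (by rw [ends_south, Finset.pair_comm]) heE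
        (ends_east _) (ends_west _) (by rw [ends_north, Finset.pair_comm]) hc hd (by simp)
        (by simp) hEV, hwe]
    · rw [NN, step_h _ _ _ _ (G.pos (n + 1) + (1, 0)) (G.pos (n + 1)) _ _
        _ _ _ hV' hE' 
        (ends_east _) (ends_west _) (by rw [ends_north, Finset.pair_comm]) hc hd,
        PMs_card _ _ hn]

end SnakeGraph


/-! ### Transfer matrices -/

def MM (τ : Bool) : Matrix Bool Bool ℕ := Matrix.of fun x y => if x = y ∨ x = τ then 1 else 0

def PP (b : ℕ → Bool) (m : ℕ) : ℕ → Matrix Bool Bool ℕ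
  | 0 => 1
  | k + 1 => PP b m k * MM (b (m + k))

def tot (A : Matrix Bool Bool ℕ) : ℕ := ∑ x, ∑ y, A x y

theorem PP_add (b : ℕ → Bool) (m k l : ℕ) :
    PP b m (k + l) = PP b m k * PP b (m + k) l := by
  induction l with
  | zero => simp [PP]
  | succ l ih => rw [← add_assoc, PP, PP, ih, Matrix.mul_assoc, add_assoc]

theorem PP_one (b : ℕ → Bool) (m : ℕ) : PP b m 1 = MM (b m) := by simp [PP]

theorem PP_head (b : ℕ → Bool) (m k : ℕ) :
    PP b m (k + 1) = MM (b m) * PP b (m + 1) k := by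
  rw [add_comm k, PP_add, PP_one]

theorem PP_congr (b b' : ℕ → Bool) (m m' k : ℕ) (h : ∀ i < k, b (m + i) = b' (m' + i)) :
    PP b m k = PP b' m' k := by
  induction k with
  | zero => rfl
  | succ k ih => rw [PP, PP, ih (fun i hi => h i (by omega)), h k (by omega)]

theorem MM_not (τ x y : Bool) : MM (!τ) x y = MM τ (!x) (!y) := by
  cases τ <;> cases x <;> cases y <;> rfl

theorem MM_transpose (τ : Bool) : (MM τ).transpose = MM (!τ) := by
  ext x y
  cases τ <;> cases x <;> cases y <;> rfl

theorem PP_not (b b' : ℕ → Bool) (m k : ℕ) (h : ∀ i, b' i = ! b i) (x y : Bool) :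
    PP b' m k x y = PP b m k (!x) (!y) := by
  induction k generalizing x y with
  | zero => cases x <;> cases y <;> rfl
  | succ k ih =>
    simp only [PP, Matrix.mul_apply, Fintype.sum_bool, ih, h, MM_not]
    simp [add_comm]

theorem tot_PP_xor (b : ℕ → Bool) (c : Bool) (m k : ℕ) :
    tot (PP (fun i => xor c (b i)) m k) = tot (PP b m k) := by
  cases c
  · simp
  · simp only [tot, Fintype.sum_bool, PP_not b (fun i => xor true (b i)) m k (by simp)]
    simp only [Bool.not_true, Bool.not_false]
    ring

theorem PP_rev (b b' : ℕ → Bool) (m m' k : ℕ)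
    (h : ∀ i < k, b' (m' + i) = ! b (m + (k - 1 - i))) :
    PP b' m' k = (PP b m k).transpose := by
  induction k generalizing m with
  | zero => simp [PP]
  | succ k ih =>
    rw [PP, PP_head, Matrix.transpose_mul, MM_transpose, h k (by omega), ih (m + 1)]
    · simp
    · intro i hi
      rw [h i (by omega)]
      congr 2
      omega

theorem tot_transpose (A : Matrix Bool Bool ℕ) : tot A.transpose = tot A := by
  simp [tot]; ring

theorem back_none (b : ℕ → Bool) (β : Bool) (m k : ℕ) (h : ∀ i < k, b (m + i) ≠ β) :
    ∑ y, PP b m k β y = 1 := by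
  induction k generalizing m with
  | zero => cases β <;> simp [PP, Matrix.one_apply]
  | succ k ih =>
    have h0 : b m = !β := Bool.eq_not.2 (h 0 (by omega))
    have := ih (m + 1) (fun i hi => by
      have := h (i + 1) (by omega); rwa [show m + 1 + i = m + (i + 1) by omega])
    rw [PP_head, h0]
    cases β <;> simpa [Matrix.mul_apply, MM] using this

theorem back_some (b : ℕ → Bool) (β : Bool) (m j k : ℕ) (hb : b (m + j) = β)
    (h : ∀ i < j, b (m + i) ≠ β) :
    ∑ y, PP b m (j + 1 + k) β y = tot (PP b (m + j + 1) k) := by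
  induction j generalizing m with
  | zero =>
    rw [zero_add, add_comm 1, PP_head, show b m = β from hb]
    cases β <;> simp [Matrix.mul_apply, MM, tot] <;> ring
  | succ j ih =>
    have h0 : b m = !β := Bool.eq_not.2 (h 0 (by omega))
    have := ih (m + 1) (by rwa [show m + 1 + j = m + (j + 1) by omega]) (fun i hi => by
      have := h (i + 1) (by omega); rwa [show m + 1 + i = m + (i + 1) by omega])
    rw [show j + 1 + 1 + k = (j + 1 + k) + 1 by omega, PP_head, h0,
      show m + (j + 1) + 1 = m + 1 + j + 1 by omega, ← this]
    cases β <;> simp [Matrix.mul_apply, MM]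

theorem front_none (b : ℕ → Bool) (β : Bool) (m k : ℕ) (h : ∀ i < k, b (m + i) ≠ β) :
    ∑ x, PP b m k x (!β) = 1 := by
  induction k with
  | zero => cases β <;> simp [PP, Matrix.one_apply]
  | succ k ih =>
    have h0 : b (m + k) = !β := Bool.eq_not.2 (h k (by omega))
    have := ih (fun i hi => h i (by omega))
    rw [PP, h0]
    cases β <;> simpa [Matrix.mul_apply, MM] using this

theorem front_some (b : ℕ → Bool) (β : Bool) (m j k : ℕ) (hb : b (m + j) = β)
    (h : ∀ i < k, b (m + j + 1 + i) ≠ β) :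
    ∑ x, PP b m (j + 1 + k) x (!β) = tot (PP b m j) := by
  induction k with
  | zero =>
    rw [add_zero, PP, hb]
    cases β <;> simp [Matrix.mul_apply, MM, tot] <;> ring
  | succ k ih =>
    have h0 : b (m + (j + 1 + k)) = !β := by
      have := h k (by omega)
      rw [show m + j + 1 + k = m + (j + 1 + k) by omega] at this
      exact Bool.eq_not.2 this
    have := ih (fun i hi => h i (by omega))
    rw [show j + 1 + (k + 1) = (j + 1 + k) + 1 by omega, PP, h0, ← this]
    cases β <;> simp [Matrix.mul_apply, MM]

namespace SnakeGraph

/-- Sign of the `i`-th interior edge for a standard sign function. -/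
def sg (G : SnakeGraph) (i : ℕ) : Bool := xor (G.step i) i.bodd

theorem counts (G : SnakeGraph) (k : ℕ) :
    G.NN (k + 1) = ∑ x, PP G.sg 1 k x (k + 1).bodd ∧
    G.EN (k + 1) = ∑ x, PP G.sg 1 k x (! (k + 1).bodd) := by
  induction k with
  | zero => rw [G.base_counts.1, G.base_counts.2]; simp [PP, Matrix.one_apply]
  | succ k ih =>
    have h := G.step_counts (k + 1) (by omega)
    rw [ih.1, ih.2] at h
    rw [PP, add_comm 1 k, sg, Nat.bodd_succ (k + 1)]
    generalize (k + 1).bodd = z at *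
    cases hs : G.step (k + 1) <;> cases z <;>
      simp [hs, Matrix.mul_apply, MM] at h ⊢ <;> omega

theorem card_eq (G : SnakeGraph) : G.matchings.card = tot (PP G.sg 1 (G.d - 1)) := by
  obtain ⟨k, hk⟩ : ∃ k, G.d = k + 1 := ⟨G.d - 1, by have := G.one_le_d; omega⟩
  rw [matchings_eq, hk, PMs_card _ _ (by omega), (G.counts k).1, (G.counts k).2,
    Nat.add_sub_cancel]
  cases (k + 1).bodd <;> simp [tot] <;> omega

theorem card_of (G : SnakeGraph) (b : ℕ → Bool) (m : ℕ) (c : Bool)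
    (h : ∀ i, 1 ≤ i → i < G.d → b (m + i) = xor c (G.sg i)) :
    G.matchings.card = tot (PP b (m + 1) (G.d - 1)) := by
  rw [card_eq, ← tot_PP_xor _ c]
  congr 1
  apply PP_congr
  intro i hi
  rw [← h (1 + i) (by omega) (by omega), add_assoc]

theorem sign_north (G : SnakeGraph) (f : Edge → Bool) (hf : G.IsSignFunction f) :
    ∃ c, ∀ i, 1 ≤ i → i ≤ G.d → f (northEdge (G.pos i)) = xor c i.bodd := by
  refine ⟨! f (northEdge (G.pos 1)), ?_⟩
  intro i hi
  induction i, hi using Nat.le_induction with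
  | base => simp
  | succ n hn ih =>
    intro hd
    have h1 := ih (by omega)
    obtain ⟨a1, a2, a3⟩ := hf n hn (by omega)
    obtain ⟨b1, b2, b3⟩ := hf (n + 1) (by omega) hd
    rw [Nat.bodd_succ]
    cases hs : G.step n
    · have hq : G.pos (n + 1) = G.pos n + (0, 1) := by rw [pos_succ _ _ hn]; simp [hs]
      have hwe : southEdge (G.pos (n + 1)) = northEdge (G.pos n) := by
        rw [hq]; rfl
      rw [b3, hwe, h1]; simp
    · have hq : G.pos (n + 1) = G.pos n + (1, 0) := by rw [pos_succ _ _ hn]; simp [hs]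
      have hwe : westEdge (G.pos (n + 1)) = eastEdge (G.pos n) := by
        rw [hq]; rfl
      rw [b1, hwe, ← a2]
      rw [h1] at a3
      generalize f (southEdge (G.pos n)) = z at *
      cases z <;> simp_all

theorem sign_int (G : SnakeGraph) (f : Edge → Bool) (hf : G.IsSignFunction f) (c : Bool)
    (hc : ∀ i, 1 ≤ i → i ≤ G.d → f (northEdge (G.pos i)) = xor c i.bodd) (i : ℕ)
    (h1 : 1 ≤ i) (h2 : i ≤ G.d) :
    f (eastEdge (G.pos i)) = (! xor c i.bodd) ∧ f (G.intEdge i) = xor c (G.sg i) := by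
  obtain ⟨a1, a2, a3⟩ := hf i h1 h2
  have h := hc i h1 h2
  have he : f (eastEdge (G.pos i)) = (! xor c i.bodd) := by
    rw [← a2, ← h, a3]; simp
  refine ⟨he, ?_⟩
  rw [intEdge, sg]
  cases G.step i <;> simp [h, he]

end SnakeGraph

theorem card_sub (G H : SnakeGraph) (a e : ℕ) (ha : 1 ≤ a) (hae : a ≤ e) (hed : e ≤ G.d)
    (b : ℕ → Bool) (c : Bool)
    (hb : ∀ i, 1 ≤ i → i < G.d → b i = xor c (G.sg i)) (h : SubSpec G a e H) :
    H.matchings.card = tot (PP b a (e - a)) := by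
  obtain ⟨a, rfl⟩ : ∃ a', a = a' + 1 := ⟨a - 1, by omega⟩
  obtain ⟨h1, h2⟩ := h
  rw [H.card_of b a (xor c a.bodd), h1]
  · rfl
  · intro i hi hid
    rw [hb _ (by omega) (by omega), SnakeGraph.sg, SnakeGraph.sg, h2 i hi hid,
      show i + (a + 1) - 1 = a + i by omega, Nat.bodd_add]
    cases c <;> cases G.step (a + i) <;> cases a.bodd <;> cases i.bodd <;> rfl

theorem card_rev (G H : SnakeGraph) (a : ℕ) (ha : 1 ≤ a) (had : a ≤ G.d)
    (b : ℕ → Bool) (c : Bool)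
    (hb : ∀ i, 1 ≤ i → i < G.d → b i = xor c (G.sg i)) (h : RevSubSpec G a G.d H) :
    H.matchings.card = tot (PP b a (G.d - a)) := by
  obtain ⟨h1, h2⟩ := h
  rw [H.card_of (fun i => xor (xor c G.d.bodd) (H.sg i)) 0 (xor c G.d.bodd), h1,
    ← tot_transpose (PP b a (G.d - a)), ← PP_rev b _ a (0 + 1)]
  · rfl
  · intro i hi
    rw [hb _ (by omega) (by omega), SnakeGraph.sg, SnakeGraph.sg, h2 _ (by omega) (by omega),
      show a + (G.d - a - 1 - i) = G.d - (0 + 1 + i) by omega]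
    have : G.d.bodd = xor (G.d - (0 + 1 + i)).bodd (0 + 1 + i).bodd := by
      rw [← Nat.bodd_add]; congr 1; omega
    rw [this]
    cases c <;> cases G.step _ <;> cases Nat.bodd (G.d - _) <;> cases Nat.bodd (0 + 1 + i) <;> rfl
  · intro i _ _
    simp

theorem card_five (G : SnakeGraph) (s : ℕ) (hs1 : 1 < s) (hsd : s ≤ G.d) (f : Edge → Bool)
    (c β : Bool) (hb : ∀ i, 1 ≤ i → i < G.d → f (G.intEdge i) = xor c (G.sg i))
    (G5 : SnakeOrEdge) (h : Graft5Aux G s f β G5) :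
    G5.matchings.card = ∑ x, PP (fun i => f (G.intEdge i)) 1 (s - 1) x (!β) := by
  rcases h with ⟨k, k1, k2, k3, k4, H, rfl, hH⟩ | ⟨h, e, rfl, -⟩
  · rw [SnakeOrEdge.matchings, card_sub G H 1 k le_rfl k1 (by omega) _ c hb hH,
      show s - 1 = (k - 1) + 1 + (s - 1 - k) by omega, front_some _ β]
    · rwa [show 1 + (k - 1) = k by omega]
    · intro i hi
      exact k4 _ (by omega) (by omega)
  · rw [front_none]
    · rfl
    · intro i hi
      exact h _ (by omega) (by omega)

theorem card_three (G1 G2 G3 : SnakeGraph) (s : ℕ) (hs1 : 1 < s) (hsd : s ≤ G1.d) (δ3 : Edge)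
    (b1 b2 : ℕ → Bool) (c c2 : Bool)
    (hb1 : ∀ i, 1 ≤ i → i < G1.d → b1 i = xor c (G1.sg i))
    (hb2 : ∀ i, 1 ≤ i → i < G2.d → b2 i = xor c2 (G2.sg i))
    (hc : c2 = xor c s.bodd)
    (h : Graft3Spec G1 G2 s δ3 G3) :
    G3.matchings.card = tot (PP b1 1 (s - 1) * MM (xor c (G3.sg s)) * PP b2 1 (G2.d - 1)) := by
  obtain ⟨h1, h2, -, -, h5⟩ := h
  have hd2 := G2.one_le_d
  rw [G3.card_of (fun i => xor c (G3.sg i)) 0 c (by simp), h1,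
    show s + G2.d - 1 = (s - 1) + 1 + (G2.d - 1) by omega, PP_add, PP_add, PP_one]
  refine congrArg tot (congrArg₂ _ (congrArg₂ _ ?_ (congrArg MM ?_)) ?_)
  · apply PP_congr
    intro i hi
    rw [zero_add, hb1 _ (by omega) (by omega), SnakeGraph.sg, SnakeGraph.sg,
      h2 _ (by omega) (by omega)]
  · rw [show 0 + 1 + (s - 1) = s by omega]
  · apply PP_congr
    intro i hi
    rw [hb2 _ (by omega) (by omega), SnakeGraph.sg, SnakeGraph.sg,
      show 0 + 1 + (s - 1 + 1) + i = s + (1 + i) by omega,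
      h5 _ (by omega) (by omega), Nat.add_sub_cancel_left, hc, Nat.bodd_add s]
    cases c <;> cases G2.step _ <;> cases Nat.bodd s <;> cases Nat.bodd (1 + i) <;> rfl

theorem card_six (G1 G2 H : SnakeGraph) (s : ℕ) (hs1 : 1 < s) (hsd : s < G1.d)
    (b1 b2 : ℕ → Bool) (c c2 : Bool)
    (hb1 : ∀ i, 1 ≤ i → i < G1.d → b1 i = xor c (G1.sg i))
    (hb2 : ∀ i, 1 ≤ i → i < G2.d → b2 i = xor c2 (G2.sg i))
    (hc : c2 = xor c s.bodd)
    (h1 : H.d = G2.d + (G1.d - s))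
    (h2 : ∀ i, 1 ≤ i → i < G2.d → H.step i = ! G2.step (G2.d - i))
    (h3 : H.step G2.d = ! G1.step s)
    (h4 : ∀ i, G2.d < i → i < H.d → H.step i = G1.step (i - G2.d + s)) :
    H.matchings.card = tot ((PP b2 1 (G2.d - 1)).transpose * MM (! b1 s) *
      PP b1 (s + 1) (G1.d - 1 - s)) := by
  have hd2 := G2.one_le_d
  rw [H.card_of (fun i => xor (xor c2 G2.d.bodd) (H.sg i)) 0 (xor c2 G2.d.bodd) (by simp), h1,
    show G2.d + (G1.d - s) - 1 = (G2.d - 1) + 1 + (G1.d - 1 - s) by omega, PP_add, PP_add, PP_one]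
  refine congrArg tot (congrArg₂ _ (congrArg₂ _ ?_ (congrArg MM ?_)) ?_)
  · apply PP_rev
    intro i hi
    rw [hb2 _ (by omega) (by omega), SnakeGraph.sg, SnakeGraph.sg, h2 _ (by omega) (by omega),
      show 1 + (G2.d - 1 - 1 - i) = G2.d - (0 + 1 + i) by omega]
    have : G2.d.bodd = xor (G2.d - (0 + 1 + i)).bodd (0 + 1 + i).bodd := by
      rw [← Nat.bodd_add]; congr 1; omega
    rw [this]
    cases c2 <;> cases G2.step _ <;> cases Nat.bodd (G2.d - _) <;>
      cases Nat.bodd (0 + 1 + i) <;> rfl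
  · rw [show 0 + 1 + (G2.d - 1) = G2.d by omega, SnakeGraph.sg, h3, hb1 _ (by omega) (by omega),
      SnakeGraph.sg, hc]
    cases c <;> cases G1.step s <;> cases Nat.bodd s <;> cases Nat.bodd G2.d <;> rfl
  · apply PP_congr
    intro i hi
    rw [hb1 _ (by omega) (by omega), SnakeGraph.sg, SnakeGraph.sg,
      show 0 + 1 + (G2.d - 1 + 1) + i = G2.d + (1 + i) by omega,
      h4 _ (by omega) (by omega), Nat.add_sub_cancel_left, hc, Nat.bodd_add G2.d,
      show s + 1 + i = 1 + i + s by omega, Nat.bodd_add _ s]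
    cases c <;> cases G1.step _ <;> cases Nat.bodd s <;> cases Nat.bodd (1 + i) <;>
      cases Nat.bodd G2.d <;> rfl

theorem grafting_card (G1 G2 : SnakeGraph) (s : ℕ)
    (hs1 : 1 < s) (hsd : s ≤ G1.d)
    (f1 f2 : Edge → Bool) (δ3 δ3' : Edge)
    (hf1 : G1.IsSignFunction f1) (hf2 : G2.IsSignFunction f2)
    (hδ : GraftEdgeSpec G1 G2 s δ3 δ3')
    (hf2δ : s = G1.d → f2 δ3' = f1 δ3)
    (G3 : SnakeGraph) (G4 G5 G6 : SnakeOrEdge)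
    (h3 : Graft3Spec G1 G2 s δ3 G3) (h4 : Graft4Spec G1 s f1 δ3 G4)
    (h5 : Graft5Spec G1 s f1 δ3 G5) (h6 : Graft6Spec G1 G2 s f1 f2 δ3 G6) :
    G1.matchings.card * G2.matchings.card =
      G3.matchings.card * G4.matchings.card +
      G5.matchings.card * G6.matchings.card := by
  obtain ⟨c, hc⟩ := G1.sign_north f1 hf1
  have hi := G1.sign_int f1 hf1 c hc
  have hb1 : ∀ i, 1 ≤ i → i < G1.d → f1 (G1.intEdge i) = xor c (G1.sg i) :=
    fun i h1 h2 => (hi i h1 h2.le).2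
  have hd2 := G2.one_le_d
  have hG1 := G1.card_of (fun i => f1 (G1.intEdge i)) 0 c (by simpa using hb1)
  rcases Nat.lt_or_ge s G1.d with hlt | hge
  · -- the case s < d
    have hne : s ≠ G1.d := hlt.ne
    simp only [Graft4Spec, Graft5Spec, Graft6Spec, hlt, hne, true_and, false_and, or_false]
      at h4 h5 h6
    obtain ⟨H6, rfl, k1, k2, k3, k4⟩ := h6
    have e5 := card_five G1 s hs1 hsd f1 c _ hb1 G5 h5
    have hb2 : ∀ i, 1 ≤ i → i < G2.d →
        (fun i => xor (xor c s.bodd) (G2.sg i)) i = xor (xor c s.bodd) (G2.sg i) :=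
      fun _ _ _ => rfl
    have hG2 := G2.card_of (fun i => xor (xor c s.bodd) (G2.sg i)) 0 (xor c s.bodd) (by simp)
    have e6 := card_six G1 G2 H6 s hs1 hlt (fun i => f1 (G1.intEdge i)) _ c _ hb1 hb2 rfl
      k1 k2 k3 k4
    have e3 := card_three G1 G2 G3 s hs1 hsd δ3 (fun i => f1 (G1.intEdge i)) _ c _ hb1 hb2 rfl h3
    have hσ : xor c (G3.sg s) = ! f1 (G1.intEdge s) := by
      rw [hb1 s (by omega) hlt, SnakeGraph.sg, SnakeGraph.sg]
      obtain ⟨-, -, q1, q2, -⟩ := h3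
      have hδ := hδ.1 hlt
      cases hs : G1.step s
      · rw [q2 (hδ.1 hs).1]; simp
      · rw [q1 (hδ.2 hs).1]; simp
    have e4 : G4.matchings.card = ∑ y, PP (fun i => f1 (G1.intEdge i)) (s + 1) (G1.d - 1 - s)
        (! f1 (G1.intEdge s)) y := by
      rcases h4 with ⟨k, q1, q2, q3, q4, H, rfl, hH⟩ | ⟨h, e, rfl, -⟩
      · rw [SnakeOrEdge.matchings, card_sub G1 H k G1.d (by omega) q2 le_rfl _ c hb1 hH,
          show G1.d - 1 - s = (k - s - 2) + 1 + (G1.d - k) by omega, back_some]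
        · rw [show s + 1 + (k - s - 2) + 1 = k by omega]
        · rw [show s + 1 + (k - s - 2) = k - 1 by omega, q3]; simp
        · intro i hi hh
          refine q4 (s + 1 + i + 1) (by omega) (by omega) ?_
          rw [Nat.add_sub_cancel, hh]; simp
      · rw [back_none]
        · rfl
        · intro i hi hh
          refine h (s + 1 + i + 1) (by omega) (by omega) ?_
          rw [Nat.add_sub_cancel, hh]; simp
    rw [hσ] at e3
    rw [show G1.d - 1 = (s - 1) + 1 + (G1.d - 1 - s) by omega, PP_add, PP_add, PP_one,
      show 0 + 1 + (s - 1) = s by omega, show 0 + 1 + (s - 1 + 1) = s + 1 by omega] at hG1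
    change _ = _ + _ * H6.matchings.card
    rw [hG1, hG2, e3, e4, e5, e6, zero_add]
    generalize PP (fun i => f1 (G1.intEdge i)) 1 (s - 1) = V
    generalize PP (fun i => f1 (G1.intEdge i)) (s + 1) (G1.d - 1 - s) = U
    generalize PP _ 1 (G2.d - 1) = W
    cases f1 (G1.intEdge s) <;>
      simp [tot, Matrix.mul_apply, MM] <;> ring
  · -- the case s = d
    have hsd : s = G1.d := by omega
    have hnlt : ¬ s < G1.d := by omega
    simp only [Graft4Spec, Graft5Spec, Graft6Spec, hnlt, false_and, false_or]
      at h4 h5 h6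
    replace h4 := h4.2
    replace h5 := h5.2
    replace h6 := h6.2
    obtain ⟨c2, hc2⟩ := G2.sign_north f2 hf2
    have hi2 := G2.sign_int f2 hf2 c2 hc2
    have hb2 : ∀ i, 1 ≤ i → i < G2.d → f2 (G2.intEdge i) = xor c2 (G2.sg i) :=
      fun i h1 h2 => (hi2 i h1 h2.le).2
    have hG2 := G2.card_of (fun i => f2 (G2.intEdge i)) 0 c2 (by simpa using hb2)
    have e5 := card_five G1 s hs1 hsd.le f1 c _ hb1 G5 h5
    have hcc : c2 = xor c s.bodd ∧ xor c (G3.sg s) = f1 δ3 := by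
      have hh := hf2δ hsd
      obtain ⟨-, -, q1, q2, -⟩ := h3
      obtain ⟨a1, a2, a3⟩ := hf2 1 le_rfl hd2
      have hn := hc s (by omega) hsd.le
      have he := (hi s (by omega) hsd.le).1
      have hn2 := hc2 1 le_rfl hd2
      rw [SnakeGraph.sg]
      rcases hδ.2 hsd with ⟨r1, r2⟩ | ⟨r1, r2⟩
      · rw [q1 r1]
        rw [r1, r2, hn] at hh
        rw [a3, hh] at hn2
        rw [r1, hn]
        revert hn2
        cases c <;> cases c2 <;> cases s.bodd <;> decide
      · rw [q2 r1]
        rw [r1, r2, he, ← a1, hn2] at hh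
        rw [r1, he]
        revert hh
        cases c <;> cases c2 <;> cases s.bodd <;> decide
    have e3 := card_three G1 G2 G3 s hs1 hsd.le δ3 (fun i => f1 (G1.intEdge i)) _ c _ hb1 hb2
      hcc.1 h3
    rw [hcc.2] at e3
    have e6 : G6.matchings.card = ∑ y, PP (fun i => f2 (G2.intEdge i)) 1 (G2.d - 1)
        (f1 δ3) y := by
      rcases h6 with ⟨k, q1, q2, q3, q4, H, rfl, hH⟩ | ⟨h, e, rfl, -⟩
      · rw [SnakeOrEdge.matchings, card_rev G2 H k (by omega) q2 _ c2 hb2 hH,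
          show G2.d - 1 = (k - 2) + 1 + (G2.d - k) by omega, back_some]
        · rw [show 1 + (k - 2) + 1 = k by omega]
        · rw [show 1 + (k - 2) = k - 1 by omega, q3]
        · intro i hi hh
          exact q4 (1 + i + 1) (by omega) (by omega) hh
      · rw [back_none]
        · rfl
        · intro i hi hh
          exact h (1 + i + 1) (by omega) (by omega) hh
    have e4 : G4.matchings.card = 1 := by rw [h4]; rfl
    rw [hG1, hG2, e3, e4, e5, e6, zero_add, ← hsd]
    generalize PP (fun i => f1 (G1.intEdge i)) 1 (s - 1) = V
    generalize PP _ 1 (G2.d - 1) = W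
    cases f1 δ3 <;>
      simp [tot, Matrix.mul_apply, MM] <;> ring

/-- Let `𝒢1 = (G_1,…,G_d)` and `𝒢2 = (G'_1,…,G'_{d'})` be snake
graphs, let `1 < s ≤ d`, and let `(𝒢3 ⊔ 𝒢4, 𝒢5 ⊔ 𝒢6) = Graft_{s,δ₃}(𝒢1,𝒢2)` be the
resolution of the grafting of `𝒢2` on `𝒢1` in `G_s`.  Then there is a bijection
between `Match(𝒢1) × Match(𝒢2)` and
`(Match(𝒢3) × Match(𝒢4)) ⊔ (Match(𝒢5) × Match(𝒢6))`; in particular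
`|Match 𝒢1|·|Match 𝒢2| = |Match 𝒢3|·|Match 𝒢4| + |Match 𝒢5|·|Match 𝒢6|`. -/
theorem grafting_matching_bijection (G1 G2 : SnakeGraph) (s : ℕ)
    (hs1 : 1 < s) (hsd : s ≤ G1.d)
    (f1 f2 : Edge → Bool) (δ3 δ3' : Edge)
    (hf1 : G1.IsSignFunction f1) (hf2 : G2.IsSignFunction f2)
    (hδ : GraftEdgeSpec G1 G2 s δ3 δ3')
    (hf2δ : s = G1.d → f2 δ3' = f1 δ3)
    (G3 : SnakeGraph) (G4 G5 G6 : SnakeOrEdge)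
    (h3 : Graft3Spec G1 G2 s δ3 G3) (h4 : Graft4Spec G1 s f1 δ3 G4)
    (h5 : Graft5Spec G1 s f1 δ3 G5) (h6 : Graft6Spec G1 G2 s f1 f2 δ3 G6) :
    Nonempty (({P // P ∈ G1.matchings} × {P // P ∈ G2.matchings}) ≃
      ({P // P ∈ G3.matchings} × {P // P ∈ G4.matchings}) ⊕
      ({P // P ∈ G5.matchings} × {P // P ∈ G6.matchings})) ∧
    G1.matchings.card * G2.matchings.card =
      G3.matchings.card * G4.matchings.card +
      G5.matchings.card * G6.matchings.card := by
  have h := grafting_card G1 G2 s hs1 hsd f1 f2 δ3 δ3' hf1 hf2 hδ hf2δ G3 G4 G5 G6 h3 h4 h5 h6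
  refine ⟨?_, h⟩
  rw [← Fintype.card_eq]
  simpa only [Fintype.card_sum, Fintype.card_prod, Fintype.card_coe] using h
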